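/- arXiv:math/0302287 — 4 statements merged into one kernel-verified Lean document; each statement's English description precedes it below -/
import Mathlib

section
/- Let n = k_e + k_h + 2k_f and let h = (h_1,...,h_n) : ℝ^{2n} → ℝ^n be the model moment map of Williamson type (k_e,k_h,k_f). Then the differentials dh_1(z),...,dh_n(z) are linearly independent at a point z = (x_1,y_1,...,x_n,y_n) if and only if (x_i,y_i) ≠ (0,0) for every elliptic or hyperbolic index i ≤ k_e+k_h and (x_i,y_i,x_{i+1},y_{i+1}) ≠ (0,0,0,0) for every focus-focus pair of indices (i,i+1). In particular, the set of points where dh_1,...,dh_n are linearly independent is a dense open subset of ℝ^{2n}, so h defines an integrable system (its components are functionally independent almost everywhere). -/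
open scoped BigOperators

/-- The `i`-th component of the model moment map of Williamson type `(k_e, k_h, k_f)`
(with `n = k_e + k_h + 2 k_f`), on `ℝ^{2n}` modeled as `Fin n → ℝ × ℝ` with
`(x_i, y_i) = z i`: elliptic components `x_i² + y_i²` for `i < k_e`, hyperbolic
components `x_i y_i` for `k_e ≤ i < k_e + k_h`, and focus-focus pairs
`x_i y_{i+1} − x_{i+1} y_i`, `x_i y_i + x_{i+1} y_{i+1}` for the remaining indices,
grouped in consecutive pairs.  (Indices are 0-based.) -/
def williamson (ke kh : ℕ) {n : ℕ} (i : Fin n) (z : Fin n → ℝ × ℝ) : ℝ :=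
  let x : ℕ → ℝ := fun j => if h : j < n then (z ⟨j, h⟩).1 else 0
  let y : ℕ → ℝ := fun j => if h : j < n then (z ⟨j, h⟩).2 else 0
  if i.val < ke then x i.val ^ 2 + y i.val ^ 2
  else if i.val < ke + kh then x i.val * y i.val
  else if (i.val - (ke + kh)) % 2 = 0 then
    x i.val * y (i.val + 1) - x (i.val + 1) * y i.val
  else x (i.val - 1) * y (i.val - 1) + x i.val * y i.val

noncomputable def wx (n j : ℕ) : (Fin n → ℝ × ℝ) →L[ℝ] ℝ :=
  if h : j < n then (ContinuousLinearMap.fst ℝ ℝ ℝ).comp (ContinuousLinearMap.proj (⟨j, h⟩ : Fin n)) else 0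

noncomputable def wy (n j : ℕ) : (Fin n → ℝ × ℝ) →L[ℝ] ℝ :=
  if h : j < n then (ContinuousLinearMap.snd ℝ ℝ ℝ).comp (ContinuousLinearMap.proj (⟨j, h⟩ : Fin n)) else 0

theorem wx_apply (n j : ℕ) (z : Fin n → ℝ × ℝ) :
    wx n j z = if h : j < n then (z ⟨j, h⟩).1 else 0 := by
  unfold wx; split <;> simp

theorem wy_apply (n j : ℕ) (z : Fin n → ℝ × ℝ) :
    wy n j z = if h : j < n then (z ⟨j, h⟩).2 else 0 := by
  unfold wy; split <;> simp

theorem williamson_eq (ke kh : ℕ) {n : ℕ} (i : Fin n) : williamson ke kh i = fun z =>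
    if i.val < ke then wx n i z ^ 2 + wy n i z ^ 2
    else if i.val < ke + kh then wx n i z * wy n i z
    else if (i.val - (ke + kh)) % 2 = 0 then
      wx n i z * wy n (i + 1) z - wx n (i + 1) z * wy n i z
    else wx n (i - 1) z * wy n (i - 1) z + wx n i z * wy n i z := by
  funext z
  simp only [williamson, wx_apply, wy_apply]

theorem hasF (n a b : ℕ) (z v : Fin n → ℝ × ℝ) :
    HasFDerivAt (fun z => wx n a z * wy n b z) (wx n a z • wy n b + wy n b z • wx n a) z :=
  (wx n a).hasFDerivAt.mul (wy n b).hasFDerivAt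

theorem williamson_fderiv (ke kh : ℕ) {n : ℕ} (i : Fin n) (z v : Fin n → ℝ × ℝ) :
    fderiv ℝ (williamson ke kh i) z v =
    if i.val < ke then 2 * (wx n i z * wx n i v + wy n i z * wy n i v)
    else if i.val < ke + kh then wx n i z * wy n i v + wy n i z * wx n i v
    else if (i.val - (ke + kh)) % 2 = 0 then
      (wx n i z * wy n (i + 1) v + wy n (i + 1) z * wx n i v)
        - (wx n (i + 1) z * wy n i v + wy n i z * wx n (i + 1) v)
    else (wx n (i - 1) z * wy n (i - 1) v + wy n (i - 1) z * wx n (i - 1) v)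
      + (wx n i z * wy n i v + wy n i z * wx n i v) := by
  rw [williamson_eq]
  split_ifs
  · have h := ((wx n i).hasFDerivAt (x := z)).pow 2 |>.add (((wy n i).hasFDerivAt (x := z)).pow 2)
    have h2 := h.fderiv
    have h3 : (fun z => wx n i z ^ 2 + wy n i z ^ 2) = ((wx n i : _ → ℝ) ^ 2 + (wy n i : _ → ℝ) ^ 2) := rfl
    rw [h3]
    erw [h2]
    simp
    ring
  · rw [(hasF n i i z v).fderiv]; simp
  · have h := ((hasF n i (i+1) z v).fun_sub (hasF n (i+1) i z v)).fderiv
    rw [h]; simp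
  · have h := ((hasF n (i-1) (i-1) z v).fun_add (hasF n i i z v)).fderiv
    rw [h]; simp

/-- dual vectors -/
noncomputable def wdual (ke kh n j : ℕ) (z : Fin n → ℝ × ℝ) (k : ℕ) : ℝ × ℝ :=
  if j < ke then (if k = j then (wx n j z, wy n j z) else 0)
  else if j < ke + kh then (if k = j then (wy n j z, wx n j z) else 0)
  else if (j - (ke + kh)) % 2 = 0 then
    (if k = j then (wy n (j+1) z, - wx n (j+1) z)
     else if k = j + 1 then (- wy n j z, wx n j z) else 0)
  else (if k = j then (wy n j z, wx n j z)
     else if k + 1 = j then (wy n (j-1) z, wx n (j-1) z) else 0)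

theorem wdual_x (ke kh n j k : ℕ) (z : Fin n → ℝ × ℝ) (hk : k < n) :
    wx n k (fun k : Fin n => wdual ke kh n j z k) = (wdual ke kh n j z k).1 := by
  simp [wx_apply, hk]

theorem wdual_y (ke kh n j k : ℕ) (z : Fin n → ℝ × ℝ) (hk : k < n) :
    wy n k (fun k : Fin n => wdual ke kh n j z k) = (wdual ke kh n j z k).2 := by
  simp [wy_apply, hk]

def wcond (ke kh n : ℕ) (z : Fin n → ℝ × ℝ) : Prop :=
  (∀ i : Fin n, i.val < ke + kh → z i ≠ 0) ∧
          ∀ i : Fin n, ke + kh ≤ i.val → (i.val - (ke + kh)) % 2 = 0 →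
            ∀ h1 : i.val + 1 < n, ¬(z i = 0 ∧ z ⟨i.val + 1, h1⟩ = 0)

theorem zero_of_w {n : ℕ} (i : Fin n) (z : Fin n → ℝ × ℝ) (hx : wx n i z = 0) (hy : wy n i z = 0) :
    z i = 0 := by
  rw [wx_apply] at hx; rw [wy_apply] at hy
  simp at hx hy
  exact Prod.ext hx hy

theorem offdiag (ke kh kf n : ℕ) (hn : n = ke + kh + 2 * kf) (z : Fin n → ℝ × ℝ) (i j : Fin n)
    (hij : i ≠ j) :
    fderiv ℝ (williamson ke kh i) z (fun k : Fin n => wdual ke kh n j z k) = 0 := by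
  have hij' : i.val ≠ j.val := fun h => hij (Fin.ext h)
  have hi := i.2
  have hj := j.2
  rw [williamson_fderiv]
  generalize i.val = i at *
  generalize j.val = j at *
  split_ifs with h1 h2 h3
  · rw [wdual_x _ _ _ _ _ _ hi, wdual_y _ _ _ _ _ _ hi]
    have : wdual ke kh n j z i = 0 := by
      unfold wdual; split_ifs <;> first | rfl | (exfalso; omega)
    simp [this]
  · rw [wdual_x _ _ _ _ _ _ hi, wdual_y _ _ _ _ _ _ hi]
    have : wdual ke kh n j z i = 0 := by
      unfold wdual; split_ifs <;> first | rfl | (exfalso; omega)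
    simp [this]
  · have hi1 : i + 1 < n := by omega
    rw [wdual_x _ _ _ _ _ _ hi, wdual_y _ _ _ _ _ _ hi, wdual_x _ _ _ _ _ _ hi1,
      wdual_y _ _ _ _ _ _ hi1]
    by_cases hji : j = i + 1
    · subst hji
      have e1 : wdual ke kh n (i+1) z i = (wy n i z, wx n i z) := by
        unfold wdual; split_ifs <;> first | rfl | (exfalso; omega)
      have e2 : wdual ke kh n (i+1) z (i+1) = (wy n (i+1) z, wx n (i+1) z) := by
        unfold wdual; split_ifs <;> first | rfl | (exfalso; omega)
      rw [e1, e2]; simp only; ring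
    · have e1 : wdual ke kh n j z i = 0 := by
        unfold wdual; split_ifs <;> first | rfl | (exfalso; omega)
      have e2 : wdual ke kh n j z (i+1) = 0 := by
        unfold wdual; split_ifs <;> first | rfl | (exfalso; omega)
      simp [e1, e2]
  · obtain ⟨m, rfl⟩ : ∃ m, i = m + 1 := ⟨i - 1, by omega⟩
    have hm : m < n := by omega
    simp only [Nat.add_sub_cancel]
    rw [wdual_x _ _ _ _ _ _ hi, wdual_y _ _ _ _ _ _ hi, wdual_x _ _ _ _ _ _ hm,
      wdual_y _ _ _ _ _ _ hm]
    by_cases hji : j = m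
    · subst hji
      have e1 : wdual ke kh n j z j = (wy n (j+1) z, - wx n (j+1) z) := by
        unfold wdual; split_ifs <;> first | rfl | (exfalso; omega)
      have e2 : wdual ke kh n j z (j+1) = (- wy n j z, wx n j z) := by
        unfold wdual; split_ifs <;> first | rfl | (exfalso; omega)
      rw [e1, e2]; simp only; ring
    · have e1 : wdual ke kh n j z m = 0 := by
        unfold wdual; split_ifs <;> first | rfl | (exfalso; omega)
      have e2 : wdual ke kh n j z (m+1) = 0 := by
        unfold wdual; split_ifs <;> first | rfl | (exfalso; omega)
      simp [e1, e2]

theorem sq2 {a b : ℝ} (h : a * a + b * b = 0) : a = 0 ∧ b = 0 := by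
  constructor <;> nlinarith [mul_self_nonneg a, mul_self_nonneg b]

theorem sq4 {a b c d : ℝ} (h : a * a + b * b + c * c + d * d = 0) :
    (a = 0 ∧ b = 0) ∧ c = 0 ∧ d = 0 := by
  refine ⟨⟨?_, ?_⟩, ?_, ?_⟩ <;>
  nlinarith [mul_self_nonneg a, mul_self_nonneg b, mul_self_nonneg c, mul_self_nonneg d]

theorem diag (ke kh kf n : ℕ) (hn : n = ke + kh + 2 * kf) (z : Fin n → ℝ × ℝ) (j : Fin n)
    (hz : wcond ke kh n z) :
    fderiv ℝ (williamson ke kh j) z (fun k : Fin n => wdual ke kh n j z k) ≠ 0 := by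
  intro h
  obtain ⟨j, hj⟩ := j
  rw [williamson_fderiv] at h
  simp only at h
  split_ifs at h with h1 h2 h3
  · rw [wdual_x _ _ _ _ _ _ hj, wdual_y _ _ _ _ _ _ hj] at h
    simp only [wdual, h1, if_true] at h
    obtain ⟨a, b⟩ := sq2 (a := wx n j z) (b := wy n j z) (by linarith)
    exact hz.1 ⟨j, hj⟩ (by simp only; omega) (zero_of_w ⟨j, hj⟩ z a b)
  · rw [wdual_x _ _ _ _ _ _ hj, wdual_y _ _ _ _ _ _ hj] at h
    simp only [wdual, h1, h2, if_true, if_false] at h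
    obtain ⟨a, b⟩ := sq2 (a := wx n j z) (b := wy n j z) (by linarith)
    exact hz.1 ⟨j, hj⟩ (by simp only; omega) (zero_of_w ⟨j, hj⟩ z a b)
  · have hj1 : j + 1 < n := by omega
    rw [wdual_x _ _ _ _ _ _ hj, wdual_y _ _ _ _ _ _ hj, wdual_x _ _ _ _ _ _ hj1,
      wdual_y _ _ _ _ _ _ hj1] at h
    have e1 : wdual ke kh n j z j = (wy n (j+1) z, - wx n (j+1) z) := by
      unfold wdual; split_ifs <;> first | rfl | (exfalso; omega)
    have e2 : wdual ke kh n j z (j+1) = (- wy n j z, wx n j z) := by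
      unfold wdual; split_ifs <;> first | rfl | (exfalso; omega)
    rw [e1, e2] at h
    obtain ⟨⟨a, b⟩, c, d⟩ := sq4 (a := wx n j z) (b := wy n j z) (c := wx n (j+1) z)
      (d := wy n (j+1) z) (by simp only at h; linarith)
    exact hz.2 ⟨j, hj⟩ (by simp only; omega) h3 hj1
      ⟨zero_of_w ⟨j, hj⟩ z a b, zero_of_w ⟨j + 1, hj1⟩ z c d⟩
  · obtain ⟨m, rfl⟩ : ∃ m, j = m + 1 := ⟨j - 1, by omega⟩
    have hm : m < n := by omega
    simp only [Nat.add_sub_cancel] at h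
    rw [wdual_x _ _ _ _ _ _ hj, wdual_y _ _ _ _ _ _ hj, wdual_x _ _ _ _ _ _ hm,
      wdual_y _ _ _ _ _ _ hm] at h
    have e1 : wdual ke kh n (m+1) z m = (wy n m z, wx n m z) := by
      unfold wdual; split_ifs <;> first | rfl | (exfalso; omega)
    have e2 : wdual ke kh n (m+1) z (m+1) = (wy n (m+1) z, wx n (m+1) z) := by
      unfold wdual; split_ifs <;> first | rfl | (exfalso; omega)
    rw [e1, e2] at h
    obtain ⟨⟨a, b⟩, c, d⟩ := sq4 (a := wx n m z) (b := wy n m z) (c := wx n (m+1) z)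
      (d := wy n (m+1) z) (by simp only at h; linarith)
    exact hz.2 ⟨m, hm⟩ (by simp only; omega) (by simp only; omega) hj
      ⟨zero_of_w ⟨m, hm⟩ z a b, zero_of_w ⟨m + 1, hj⟩ z c d⟩

theorem w_iff (ke kh kf n : ℕ) (hn : n = ke + kh + 2 * kf) (z : Fin n → ℝ × ℝ) :
    (LinearIndependent ℝ fun i : Fin n => fderiv ℝ (williamson ke kh i) z) ↔ wcond ke kh n z := by
  constructor
  · intro h
    refine ⟨fun i hi hz => h.ne_zero i ?_, fun i hi hp h1 hz => h.ne_zero i ?_⟩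
    · ext1 v
      have a : wx n i z = 0 := by rw [wx_apply]; simp [hz]
      have b : wy n i z = 0 := by rw [wy_apply]; simp [hz]
      rw [williamson_fderiv]
      simp [a, b, hi]
    · ext1 v
      have a : wx n i z = 0 := by rw [wx_apply]; simp [hz.1]
      have b : wy n i z = 0 := by rw [wy_apply]; simp [hz.1]
      have c : wx n (i+1) z = 0 := by rw [wx_apply]; simp [hz.2]
      have d : wy n (i+1) z = 0 := by rw [wy_apply]; simp [hz.2]
      rw [williamson_fderiv]
      simp [a, b, c, d, hp]
  · intro hz
    rw [Fintype.linearIndependent_iff]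
    intro g hg j
    have h := congrArg (fun L => L (fun k : Fin n => wdual ke kh n j z k)) hg
    simp only [ContinuousLinearMap.sum_apply, ContinuousLinearMap.smul_apply, smul_eq_mul,
      ContinuousLinearMap.zero_apply] at h
    rw [Finset.sum_eq_single j (fun i _ hi => by rw [offdiag ke kh kf n hn z i j hi, mul_zero])
      (by simp)] at h
    exact (mul_eq_zero.1 h).resolve_right (diag ke kh kf n hn z j hz)

/-- the differentials `dh_1(z), ..., dh_n(z)` of the model moment map
of Williamson type `(k_e,k_h,k_f)` are linearly independent at `z` if and only if
`(x_i,y_i) ≠ (0,0)` for every elliptic or hyperbolic index `i < k_e + k_h` and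
`(x_i,y_i,x_{i+1},y_{i+1}) ≠ 0` for every focus-focus pair `(i, i+1)`.
In particular the set of such points is open and dense in `ℝ^{2n}`, so the
components of `h` are functionally independent almost everywhere. -/
theorem williamson_fderiv_linearIndependent_iff (ke kh kf n : ℕ)
    (hn : n = ke + kh + 2 * kf) :
    (∀ z : Fin n → ℝ × ℝ,
      (LinearIndependent ℝ fun i : Fin n => fderiv ℝ (williamson ke kh i) z) ↔
        ((∀ i : Fin n, i.val < ke + kh → z i ≠ 0) ∧
          ∀ i : Fin n, ke + kh ≤ i.val → (i.val - (ke + kh)) % 2 = 0 →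
            ∀ h1 : i.val + 1 < n, ¬(z i = 0 ∧ z ⟨i.val + 1, h1⟩ = 0))) ∧
    IsOpen {z : Fin n → ℝ × ℝ |
      LinearIndependent ℝ fun i : Fin n => fderiv ℝ (williamson ke kh i) z} ∧
    Dense {z : Fin n → ℝ × ℝ |
      LinearIndependent ℝ fun i : Fin n => fderiv ℝ (williamson ke kh i) z} := by
  have hiff := w_iff ke kh kf n hn
  refine ⟨hiff, ?_, ?_⟩
  · simp only [hiff, wcond, Set.setOf_and, Set.setOf_forall]
    have hc : ∀ i : Fin n, IsClosed {z : Fin n → ℝ × ℝ | z i = 0} := fun i =>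
      isClosed_eq (continuous_apply i) continuous_const
    refine IsOpen.inter ?_ ?_
    · exact isOpen_iInter_of_finite fun i => isOpen_iInter_of_finite fun _ => (hc i).isOpen_compl
    · exact isOpen_iInter_of_finite fun i => isOpen_iInter_of_finite fun _ =>
        isOpen_iInter_of_finite fun _ => isOpen_iInter_of_finite fun h1 =>
          ((hc i).inter (hc ⟨i.val + 1, h1⟩)).isOpen_compl
  · have hd : Dense (Set.pi Set.univ fun _ : Fin n => ({0}ᶜ : Set (ℝ × ℝ))) :=
      dense_pi _ fun _ _ => dense_compl_singleton 0
    refine hd.mono fun z hz => ?_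
    have hz' : ∀ i, z i ≠ 0 := fun i => hz i (Set.mem_univ i)
    exact (hiff z).2 ⟨fun i _ => hz' i, fun i _ _ _ h => hz' i h.1⟩
end

section
/- (Sublemma: tangency to the singular Lagrangian fibration implies commutation.) Let n = k_e + k_h + 2k_f, let h = (h_1,...,h_n) : ℝ^{2n} → ℝ^n be the model moment map of Williamson type (k_e,k_h,k_f), let U ⊆ ℝ^{2n} be open, and let G_1, G_2 : U → ℝ be smooth functions such that {G_1, h_j} = 0 and {G_2, h_j} = 0 on U for every j = 1,...,n (i.e. the Hamiltonian vector fields of G_1 and G_2 are tangent to the fibration given by h). Then {G_1, G_2} = 0 on all of U. -/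
open scoped BigOperators

/-- The Poisson bracket on `ℝ^{2n}`, modeled as `Fin n → ℝ × ℝ` with coordinates
`(x_i, y_i) = z i`:  `{F,G} = Σ_i (∂F/∂x_i ∂G/∂y_i − ∂F/∂y_i ∂G/∂x_i)`. -/
noncomputable def poissonBracket {n : ℕ} (F G : (Fin n → ℝ × ℝ) → ℝ)
    (z : Fin n → ℝ × ℝ) : ℝ :=
  ∑ i : Fin n,
    (fderiv ℝ F z (Pi.single i (1, 0)) * fderiv ℝ G z (Pi.single i (0, 1)) -
      fderiv ℝ F z (Pi.single i (0, 1)) * fderiv ℝ G z (Pi.single i (1, 0)))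

lemma pb_fst {n : ℕ} (G : (Fin n → ℝ × ℝ) → ℝ) (z : Fin n → ℝ × ℝ) (i : Fin n) :
    poissonBracket G (fun w => (w i).1) z = - fderiv ℝ G z (Pi.single i (0, 1)) := by
  have h : fderiv ℝ (fun w : Fin n → ℝ × ℝ => (w i).1) z =
      (ContinuousLinearMap.fst ℝ ℝ ℝ).comp (ContinuousLinearMap.proj i) :=
    ((ContinuousLinearMap.fst ℝ ℝ ℝ).comp
      (ContinuousLinearMap.proj (R := ℝ) (φ := fun _ : Fin n => ℝ × ℝ) i)).hasFDerivAt.fderiv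
  unfold poissonBracket
  rw [h, Finset.sum_eq_single i]
  · simp
  · intro b _ hb
    simp [Pi.single_eq_of_ne hb.symm]
  · simp

lemma pb_snd {n : ℕ} (G : (Fin n → ℝ × ℝ) → ℝ) (z : Fin n → ℝ × ℝ) (i : Fin n) :
    poissonBracket G (fun w => (w i).2) z = fderiv ℝ G z (Pi.single i (1, 0)) := by
  have h : fderiv ℝ (fun w : Fin n → ℝ × ℝ => (w i).2) z =
      (ContinuousLinearMap.snd ℝ ℝ ℝ).comp (ContinuousLinearMap.proj i) :=
    ((ContinuousLinearMap.snd ℝ ℝ ℝ).comp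
      (ContinuousLinearMap.proj (R := ℝ) (φ := fun _ : Fin n => ℝ × ℝ) i)).hasFDerivAt.fderiv
  unfold poissonBracket
  rw [h, Finset.sum_eq_single i]
  · simp
  · intro b _ hb
    simp [Pi.single_eq_of_ne hb.symm]
  · simp

lemma pb_mul {n : ℕ} (G A B : (Fin n → ℝ × ℝ) → ℝ) (z : Fin n → ℝ × ℝ)
    (hA : DifferentiableAt ℝ A z) (hB : DifferentiableAt ℝ B z) :
    poissonBracket G (fun w => A w * B w) z =
      A z * poissonBracket G B z + B z * poissonBracket G A z := by
  unfold poissonBracket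
  rw [fderiv_fun_mul hA hB, Finset.mul_sum, Finset.mul_sum, ← Finset.sum_add_distrib]
  refine Finset.sum_congr rfl fun i _ => ?_
  simp
  ring

lemma pb_add {n : ℕ} (G A B : (Fin n → ℝ × ℝ) → ℝ) (z : Fin n → ℝ × ℝ)
    (hA : DifferentiableAt ℝ A z) (hB : DifferentiableAt ℝ B z) :
    poissonBracket G (fun w => A w + B w) z =
      poissonBracket G A z + poissonBracket G B z := by
  unfold poissonBracket
  rw [fderiv_fun_add hA hB, ← Finset.sum_add_distrib]
  refine Finset.sum_congr rfl fun i _ => ?_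
  simp
  ring

lemma pb_sub {n : ℕ} (G A B : (Fin n → ℝ × ℝ) → ℝ) (z : Fin n → ℝ × ℝ)
    (hA : DifferentiableAt ℝ A z) (hB : DifferentiableAt ℝ B z) :
    poissonBracket G (fun w => A w - B w) z =
      poissonBracket G A z - poissonBracket G B z := by
  unfold poissonBracket
  rw [fderiv_fun_sub hA hB, ← Finset.sum_sub_distrib]
  refine Finset.sum_congr rfl fun i _ => ?_
  simp
  ring

lemma sum_blocks (T : ℕ → ℝ) (m k : ℕ) (h1 : ∀ i < m, T i = 0)
    (h2 : ∀ j < k, T (m + 2 * j) + T (m + 2 * j + 1) = 0) :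
    ∑ i ∈ Finset.range (m + 2 * k), T i = 0 := by
  induction k with
  | zero => exact Finset.sum_eq_zero fun i hi => h1 i (by simpa using hi)
  | succ k ih =>
    rw [show m + 2 * (k + 1) = m + 2 * k + 1 + 1 by ring, Finset.sum_range_succ,
      Finset.sum_range_succ, ih fun j hj => h2 j (by omega), add_assoc, h2 k (by omega)]
    simp

lemma w_ell {ke kh n : ℕ} (G : (Fin n → ℝ × ℝ) → ℝ) (z : Fin n → ℝ × ℝ) (i : Fin n)
    (hi : i.val < ke) (h : poissonBracket G (fun w => williamson ke kh i w) z = 0) :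
    (z i).2 * fderiv ℝ G z (Pi.single i (1, 0)) =
      (z i).1 * fderiv ℝ G z (Pi.single i (0, 1)) := by
  have e : (fun w : Fin n → ℝ × ℝ => williamson ke kh i w) =
      fun w => (w i).1 * (w i).1 + (w i).2 * (w i).2 := by
    funext w
    simp [williamson, hi, sq]
  rw [e, pb_add _ _ _ _ (by fun_prop) (by fun_prop), pb_mul _ _ _ _ (by fun_prop) (by fun_prop),
    pb_mul _ _ _ _ (by fun_prop) (by fun_prop), pb_fst, pb_snd] at h
  linarith

lemma w_hyp {ke kh n : ℕ} (G : (Fin n → ℝ × ℝ) → ℝ) (z : Fin n → ℝ × ℝ) (i : Fin n)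
    (hi : ¬ i.val < ke) (hi' : i.val < ke + kh)
    (h : poissonBracket G (fun w => williamson ke kh i w) z = 0) :
    (z i).1 * fderiv ℝ G z (Pi.single i (1, 0)) =
      (z i).2 * fderiv ℝ G z (Pi.single i (0, 1)) := by
  have e : (fun w : Fin n → ℝ × ℝ => williamson ke kh i w) =
      fun w => (w i).1 * (w i).2 := by
    funext w
    simp [williamson, hi, hi']
  rw [e, pb_mul _ _ _ _ (by fun_prop) (by fun_prop), pb_fst, pb_snd] at h
  linarith

lemma w_ff1 {ke kh n : ℕ} (G : (Fin n → ℝ × ℝ) → ℝ) (z : Fin n → ℝ × ℝ) (i i' : Fin n) (j : ℕ)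
    (hi : i.val = ke + kh + 2 * j) (hi' : i'.val = i.val + 1)
    (h : poissonBracket G (fun w => williamson ke kh i w) z = 0) :
    (z i).1 * fderiv ℝ G z (Pi.single i' (1, 0)) + (z i).2 * fderiv ℝ G z (Pi.single i' (0, 1)) =
      (z i').1 * fderiv ℝ G z (Pi.single i (1, 0))
        + (z i').2 * fderiv ℝ G z (Pi.single i (0, 1)) := by
  have e : (fun w : Fin n → ℝ × ℝ => williamson ke kh i w) =
      fun w => (w i).1 * (w i').2 - (w i').1 * (w i).2 := by
    funext w
    have h1 : ¬ i.val < ke := by omega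
    have h2 : ¬ i.val < ke + kh := by omega
    have h3 : (i.val - (ke + kh)) % 2 = 0 := by omega
    have h4 := i'.isLt
    simp only [williamson, h1, h2, h3, if_true, if_false, ← hi']
    simp
  rw [e, pb_sub _ _ _ _ (by fun_prop) (by fun_prop), pb_mul _ _ _ _ (by fun_prop) (by fun_prop),
    pb_mul _ _ _ _ (by fun_prop) (by fun_prop), pb_fst, pb_snd, pb_fst, pb_snd] at h
  linarith

lemma w_ff2 {ke kh n : ℕ} (G : (Fin n → ℝ × ℝ) → ℝ) (z : Fin n → ℝ × ℝ) (i i' : Fin n) (j : ℕ)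
    (hi : i.val = ke + kh + 2 * j) (hi' : i'.val = i.val + 1)
    (h : poissonBracket G (fun w => williamson ke kh i' w) z = 0) :
    (z i).1 * fderiv ℝ G z (Pi.single i (1, 0)) + (z i').1 * fderiv ℝ G z (Pi.single i' (1, 0)) =
      (z i).2 * fderiv ℝ G z (Pi.single i (0, 1))
        + (z i').2 * fderiv ℝ G z (Pi.single i' (0, 1)) := by
  have e : (fun w : Fin n → ℝ × ℝ => williamson ke kh i' w) =
      fun w => (w i).1 * (w i).2 + (w i').1 * (w i').2 := by
    funext w
    have h1 : ¬ i'.val < ke := by omega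
    have h2 : ¬ i'.val < ke + kh := by omega
    have h3 : ¬ (i'.val - (ke + kh)) % 2 = 0 := by omega
    have h4 : i'.val - 1 = i.val := by omega
    simp only [williamson, h1, h2, h3, if_false, h4]
    simp
  rw [e, pb_add _ _ _ _ (by fun_prop) (by fun_prop), pb_mul _ _ _ _ (by fun_prop) (by fun_prop),
    pb_mul _ _ _ _ (by fun_prop) (by fun_prop), pb_fst, pb_snd, pb_fst, pb_snd] at h
  linarith

lemma ff_alg (x y u v a b c d a' b' c' d' : ℝ) (hx : x ≠ 0)
    (h1 : x * c + y * d = u * a + v * b) (h2 : x * a + u * c = y * b + v * d)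
    (h1' : x * c' + y * d' = u * a' + v * b') (h2' : x * a' + u * c' = y * b' + v * d') :
    (a * b' - b * a') + (c * d' - d * c') = 0 := by
  have hp : x ^ 2 + u ^ 2 ≠ 0 := by positivity
  have ha : a * (x ^ 2 + u ^ 2) = x * (y * b + v * d) - u * (v * b - y * d) := by
    linear_combination x * h2 - u * h1
  have hc : c * (x ^ 2 + u ^ 2) = u * (y * b + v * d) + x * (v * b - y * d) := by
    linear_combination u * h2 + x * h1
  have ha' : a' * (x ^ 2 + u ^ 2) = x * (y * b' + v * d') - u * (v * b' - y * d') := by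
    linear_combination x * h2' - u * h1'
  have hc' : c' * (x ^ 2 + u ^ 2) = u * (y * b' + v * d') + x * (v * b' - y * d') := by
    linear_combination u * h2' + x * h1'
  apply mul_left_cancel₀ hp
  linear_combination b' * ha - b * ha' + d' * hc - d * hc'

lemma pb_generic (ke kh kf n : ℕ)
    (hn : n = ke + kh + 2 * kf) (G₁ G₂ : (Fin n → ℝ × ℝ) → ℝ) (z : Fin n → ℝ × ℝ)
    (hz : ∀ i, (z i).1 ≠ 0)
    (hc₁ : ∀ j : Fin n, poissonBracket G₁ (fun w => williamson ke kh j w) z = 0)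
    (hc₂ : ∀ j : Fin n, poissonBracket G₂ (fun w => williamson ke kh j w) z = 0) :
    poissonBracket G₁ G₂ z = 0 := by
  unfold poissonBracket
  rw [Finset.sum_fin_eq_sum_range]
  subst hn
  apply sum_blocks
  · intro i hi
    have hin : i < ke + kh + 2 * kf := by omega
    rw [dif_pos hin]
    have hx := hz ⟨i, hin⟩
    by_cases hk : i < ke
    · have e1 := w_ell G₁ z ⟨i, hin⟩ hk (hc₁ _)
      have e2 := w_ell G₂ z ⟨i, hin⟩ hk (hc₂ _)
      apply mul_left_cancel₀ hx
      linear_combination fderiv ℝ G₂ z (Pi.single ⟨i, hin⟩ (1, 0)) * e1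
        - fderiv ℝ G₁ z (Pi.single ⟨i, hin⟩ (1, 0)) * e2
    · have e1 := w_hyp G₁ z ⟨i, hin⟩ hk hi (hc₁ _)
      have e2 := w_hyp G₂ z ⟨i, hin⟩ hk hi (hc₂ _)
      apply mul_left_cancel₀ hx
      linear_combination fderiv ℝ G₂ z (Pi.single ⟨i, hin⟩ (0, 1)) * e1
        - fderiv ℝ G₁ z (Pi.single ⟨i, hin⟩ (0, 1)) * e2
  · intro j hj
    have h1 : ke + kh + 2 * j < ke + kh + 2 * kf := by omega
    have h2 : ke + kh + 2 * j + 1 < ke + kh + 2 * kf := by omega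
    rw [dif_pos h1, dif_pos h2]
    exact ff_alg _ _ _ _ _ _ _ _ _ _ _ _ (hz ⟨_, h1⟩)
      (w_ff1 G₁ z ⟨_, h1⟩ ⟨_, h2⟩ j rfl rfl (hc₁ _))
      (w_ff2 G₁ z ⟨_, h1⟩ ⟨_, h2⟩ j rfl rfl (hc₁ _))
      (w_ff1 G₂ z ⟨_, h1⟩ ⟨_, h2⟩ j rfl rfl (hc₂ _))
      (w_ff2 G₂ z ⟨_, h1⟩ ⟨_, h2⟩ j rfl rfl (hc₂ _))

lemma dense_generic (n : ℕ) : Dense {z : Fin n → ℝ × ℝ | ∀ i, (z i).1 ≠ 0} := by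
  have h : Dense {p : ℝ × ℝ | p.1 ≠ 0} :=
    (dense_compl_singleton (0 : ℝ)).preimage isOpenMap_fst
  have := dense_pi (Set.univ : Set (Fin n)) (s := fun _ => {p : ℝ × ℝ | p.1 ≠ 0})
    (fun i _ => h)
  convert this using 1
  ext z
  simp

/-- Sublemma: if two smooth functions `G₁, G₂` on an open set `U`
Poisson-commute with every component of the model moment map `h` of Williamson type
`(k_e,k_h,k_f)` (i.e. their Hamiltonian vector fields are tangent to the singular
Lagrangian fibration given by `h`), then `{G₁, G₂} = 0` on all of `U`. -/
theorem poissonBracket_eq_zero_of_tangent (ke kh kf n : ℕ)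
    (hn : n = ke + kh + 2 * kf) (U : Set (Fin n → ℝ × ℝ)) (hU : IsOpen U)
    (G₁ G₂ : (Fin n → ℝ × ℝ) → ℝ)
    (hG₁ : ContDiffOn ℝ (⊤ : ℕ∞) G₁ U) (hG₂ : ContDiffOn ℝ (⊤ : ℕ∞) G₂ U)
    (hc₁ : ∀ z ∈ U, ∀ j : Fin n, poissonBracket G₁ (fun w => williamson ke kh j w) z = 0)
    (hc₂ : ∀ z ∈ U, ∀ j : Fin n, poissonBracket G₂ (fun w => williamson ke kh j w) z = 0) :
    ∀ z ∈ U, poissonBracket G₁ G₂ z = 0 := by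
  have k₁ : ContinuousOn (fderiv ℝ G₁) U := hG₁.continuousOn_fderiv_of_isOpen hU (by simp)
  have k₂ : ContinuousOn (fderiv ℝ G₂) U := hG₂.continuousOn_fderiv_of_isOpen hU (by simp)
  have hcont : ContinuousOn (poissonBracket G₁ G₂) U := by
    unfold poissonBracket
    fun_prop
  intro z hz
  by_contra hne
  have ho : IsOpen (U ∩ poissonBracket G₁ G₂ ⁻¹' {0}ᶜ) :=
    hcont.isOpen_inter_preimage hU isOpen_compl_singleton
  obtain ⟨w, ⟨hwU, hw⟩, hwD⟩ := (dense_generic n).inter_open_nonempty _ ho ⟨z, hz, hne⟩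
  exact hw (pb_generic ke kh kf n hn G₁ G₂ w hwD (hc₁ w hwU) (hc₂ w hwU))
end

section
/- (The group 𝒢' of linear system-preserving symplectomorphisms is abelian.) Let n = k_e + k_h + 2k_f and let h = (h_1,...,h_n) : ℝ^{2n} → ℝ^n be the model moment map of Williamson type (k_e,k_h,k_f). Let 𝒢' be the set of invertible linear maps A : ℝ^{2n} → ℝ^{2n} that are symplectic (ω(Au,Av) = ω(u,v) for all u,v) and preserve every component of the moment map (h_i∘A = h_i for all i). Then 𝒢' is a subgroup of GL(2n,ℝ) and it is commutative: A∘B = B∘A for all A, B ∈ 𝒢'. -/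
open scoped BigOperators

/-- The standard symplectic form `ω = Σ_i dx_i ∧ dy_i` on `ℝ^{2n}`, modeled as
`Fin n → ℝ × ℝ` with `(x_i, y_i) = z i`. -/
def symplForm {n : ℕ} (u v : Fin n → ℝ × ℝ) : ℝ :=
  ∑ i : Fin n, ((u i).1 * (v i).2 - (u i).2 * (v i).1)

/-- The set `𝒢'` of invertible linear maps of `ℝ^{2n}` that are symplectic and preserve
every component of the model moment map of Williamson type `(k_e,k_h,k_f)`. -/
def linSysPres (ke kh : ℕ) (n : ℕ) :
    Set ((Fin n → ℝ × ℝ) ≃ₗ[ℝ] (Fin n → ℝ × ℝ)) :=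
  {A | (∀ u v, symplForm (A u) (A v) = symplForm u v) ∧
    ∀ (i : Fin n) (z : Fin n → ℝ × ℝ), williamson ke kh i (A z) = williamson ke kh i z}


abbrev VV (n : ℕ) := Fin n → ℝ × ℝ

def opE {n : ℕ} (i : Fin n) : VV n →ₗ[ℝ] VV n where
  toFun u := Pi.single i (2 * (u i).2, -2 * (u i).1)
  map_add' u v := by
    rw [← Pi.single_add]; congr 1; ext <;> simp <;> ring
  map_smul' c u := by
    rw [← Pi.single_smul]; congr 1; ext <;> simp <;> ring

def opH {n : ℕ} (i : Fin n) : VV n →ₗ[ℝ] VV n where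
  toFun u := Pi.single i ((u i).1, -(u i).2)
  map_add' u v := by
    rw [← Pi.single_add]; congr 1; ext <;> simp <;> ring
  map_smul' c u := by
    rw [← Pi.single_smul]; congr 1; ext <;> simp

def opF {n : ℕ} (i j : Fin n) : VV n →ₗ[ℝ] VV n where
  toFun u := Pi.single i (-(u j)) + Pi.single j (u i)
  map_add' u v := by
    simp only [Pi.add_apply, neg_add, Pi.single_add]; abel
  map_smul' c u := by
    simp only [Pi.smul_apply, ← smul_neg, Pi.single_smul, smul_add, RingHom.id_apply]

inductive Gen (ke kh : ℕ) {n : ℕ} : (VV n →ₗ[ℝ] VV n) → Prop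
  | e (i : Fin n) (h : i.val < ke) : Gen ke kh (opE i)
  | h (i : Fin n) (h1 : ke ≤ i.val) (h2 : i.val < ke + kh) : Gen ke kh (opH i)
  | f (i j : Fin n) (h1 : ke + kh ≤ i.val) (h2 : (i.val - (ke + kh)) % 2 = 0)
      (hj : j.val = i.val + 1) : Gen ke kh (opF i j)
  | g (i j : Fin n) (h1 : ke + kh ≤ i.val) (h2 : (i.val - (ke + kh)) % 2 = 0)
      (hj : j.val = i.val + 1) : Gen ke kh (opH i + opH j)

lemma sympl_single {n : ℕ} (i : Fin n) (a : ℝ × ℝ) (v : VV n) :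
    symplForm (Pi.single i a) v = a.1 * (v i).2 - a.2 * (v i).1 := by
  unfold symplForm
  rw [Finset.sum_eq_single i]
  · simp
  · intro b _ hb; simp [Pi.single_eq_of_ne hb]
  · simp

lemma sympl_add {n : ℕ} (u u' v : VV n) :
    symplForm (u + u') v = symplForm u v + symplForm u' v := by
  unfold symplForm
  rw [← Finset.sum_add_distrib]
  apply Finset.sum_congr rfl; intros; simp; ring

lemma sympl_antisymm {n : ℕ} (u v : VV n) : symplForm u v = - symplForm v u := by
  unfold symplForm
  rw [← Finset.sum_neg_distrib]
  apply Finset.sum_congr rfl; intros; ring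

lemma sympl_nondeg {n : ℕ} (u u' : VV n) (h : ∀ v, symplForm u v = symplForm u' v) :
    u = u' := by
  funext i
  have h1 := h (Pi.single i (1, 0))
  have h2 := h (Pi.single i (0, 1))
  rw [sympl_antisymm, sympl_antisymm u', sympl_single, sympl_single] at h1 h2
  ext <;> simp at h1 h2 <;> linarith

lemma gen_ham {ke kh n : ℕ} {X : VV n →ₗ[ℝ] VV n} (hX : Gen ke kh X) :
    ∃ i : Fin n, ∀ u v, symplForm (X u) v =
      williamson ke kh i (u + v) - williamson ke kh i u - williamson ke kh i v := by
  cases hX with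
  | e i h =>
    refine ⟨i, fun u v => ?_⟩
    simp [opE, sympl_single, williamson, h]; ring
  | h i h1 h2 =>
    refine ⟨i, fun u v => ?_⟩
    simp [opH, sympl_single, williamson, h2, not_lt.2 h1]; ring
  | f i j h1 h2 hj =>
    refine ⟨i, fun u v => ?_⟩
    have hlt : i.val + 1 < n := hj ▸ j.2
    have e : (⟨i.val + 1, hlt⟩ : Fin n) = j := Fin.ext hj.symm
    have n1 : ¬ i.val < ke := by omega
    simp [opF, sympl_single, sympl_add, williamson, not_lt.2 h1, n1, h2, hlt, e]; ring
  | g i j h1 h2 hj =>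
    refine ⟨j, fun u v => ?_⟩
    have e : j.val - 1 = i.val := by omega
    have n1 : ¬ j.val < ke := by omega
    have n2 : ¬ j.val < ke + kh := by omega
    have n3 : ¬ (j.val - (ke + kh)) % 2 = 0 := by omega
    simp only [williamson, n1, n2, n3, if_false, e]
    simp [opH, sympl_single, sympl_add]; ring

lemma gen_comm_A {ke kh n : ℕ} {X : VV n →ₗ[ℝ] VV n} (hX : Gen ke kh X)
    {A : VV n ≃ₗ[ℝ] VV n} (hA : A ∈ linSysPres ke kh n) (u : VV n) :
    X (A u) = A (X u) := by
  obtain ⟨i, hi⟩ := gen_ham hX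
  apply sympl_nondeg
  intro v
  obtain ⟨v, rfl⟩ := A.surjective v
  rw [hi, hA.1, hi, ← map_add, hA.2, hA.2, hA.2]

lemma opE_apply {n : ℕ} (i k : Fin n) (u : VV n) :
    opE i u k = if k = i then (2 * (u i).2, -2 * (u i).1) else 0 := by
  simp [opE, Pi.single_apply]
lemma opH_apply {n : ℕ} (i k : Fin n) (u : VV n) :
    opH i u k = if k = i then ((u i).1, -(u i).2) else 0 := by
  simp [opH, Pi.single_apply]
lemma opF_apply {n : ℕ} (i j k : Fin n) (u : VV n) :
    opF i j u k = (if k = i then -(u j) else 0) + if k = j then u i else 0 := by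
  simp [opF, Pi.single_apply]

lemma EE {n : ℕ} (i j : Fin n) : Commute (opE i) (opE j) := by
  refine LinearMap.ext fun u => funext fun k => ?_
  by_cases h : i = j
  · subst h; rfl
  · simp only [Module.End.mul_apply, opE_apply]; grind [Prod.fst_zero, Prod.snd_zero]
lemma HH {n : ℕ} (i j : Fin n) : Commute (opH i) (opH j) := by
  refine LinearMap.ext fun u => funext fun k => ?_
  by_cases h : i = j
  · subst h; rfl
  · simp only [Module.End.mul_apply, opH_apply]; grind [Prod.fst_zero, Prod.snd_zero]
lemma EH {n : ℕ} (i j : Fin n) (h : i ≠ j) : Commute (opE i) (opH j) := by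
  refine LinearMap.ext fun u => funext fun k => ?_
  simp only [Module.End.mul_apply, opE_apply, opH_apply]; grind [Prod.fst_zero, Prod.snd_zero]
lemma EF {n : ℕ} (i j l : Fin n) (h : i ≠ j) (h' : i ≠ l) : Commute (opE i) (opF j l) := by
  refine LinearMap.ext fun u => funext fun k => ?_
  simp only [Module.End.mul_apply, opE_apply, opF_apply]; simp [h, h', h.symm, h'.symm]
lemma HF {n : ℕ} (i j l : Fin n) (h : i ≠ j) (h' : i ≠ l) : Commute (opH i) (opF j l) := by
  refine LinearMap.ext fun u => funext fun k => ?_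
  simp only [Module.End.mul_apply, opH_apply, opF_apply]; simp [h, h', h.symm, h'.symm]
lemma GF {n : ℕ} (i j : Fin n) (h : i ≠ j) : Commute (opH i + opH j) (opF i j) := by
  refine LinearMap.ext fun u => funext fun k => ?_
  simp only [Module.End.mul_apply, LinearMap.add_apply, Pi.add_apply, opH_apply, opF_apply]
  by_cases h1 : k = i
  · subst h1; ext <;> simp [h, h.symm]
  · by_cases h2 : k = j
    · subst h2; ext <;> simp [h, h.symm]
    · simp [h1, h2]
lemma FF {n : ℕ} (i j i' j' : Fin n) (h : i ≠ i') (h1 : i ≠ j') (h2 : j ≠ i') (h3 : j ≠ j') :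
    Commute (opF i j) (opF i' j') := by
  refine LinearMap.ext fun u => funext fun k => ?_
  simp only [Module.End.mul_apply, opF_apply]
  simp [h, h1, h2, h3, h.symm, h1.symm, h2.symm, h3.symm]

lemma gen_comm {ke kh n : ℕ} {X Y : VV n →ₗ[ℝ] VV n} (hX : Gen ke kh X) (hY : Gen ke kh Y) :
    Commute X Y := by
  have GF' : ∀ i j i' j' : Fin n, ke + kh ≤ i.val → (i.val - (ke + kh)) % 2 = 0 →
      j.val = i.val + 1 → ke + kh ≤ i'.val → (i'.val - (ke + kh)) % 2 = 0 →
      j'.val = i'.val + 1 → Commute (opH i + opH j) (opF i' j') := by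
    intro i j i' j' h1 h2 h3 h1' h2' h3'
    by_cases h : i = i'
    · subst h
      have : j = j' := Fin.ext (by omega)
      subst this
      exact GF _ _ (by intro h; subst h; omega)
    · have : i.val ≠ i'.val := fun e => h (Fin.ext e)
      exact (HF _ _ _ h (by intro h; subst h; omega)).add_left
        (HF _ _ _ (by intro h; subst h; omega) (by intro h; subst h; omega))
  cases hX with
  | e i h =>
    cases hY with
    | e i' h' => exact EE _ _
    | h i' h1 h2 => exact EH _ _ (by intro h; subst h; omega)
    | f i' j' h1 h2 hj =>
      exact EF _ _ _ (by intro h; subst h; omega) (by intro h; subst h; omega)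
    | g i' j' h1 h2 hj =>
      exact (EH _ _ (by intro h; subst h; omega)).add_right
        (EH _ _ (by intro h; subst h; omega))
  | h i h h0 =>
    cases hY with
    | e i' h' => exact (EH _ _ (by intro h; subst h; omega)).symm
    | h i' h1 h2 => exact HH _ _
    | f i' j' h1 h2 hj =>
      exact HF _ _ _ (by intro h; subst h; omega) (by intro h; subst h; omega)
    | g i' j' h1 h2 hj => exact (HH _ _).add_right (HH _ _)
  | f i j h1 h2 hj =>
    cases hY with
    | e i' h' => exact (EF _ _ _ (by intro h; subst h; omega) (by intro h; subst h; omega)).symm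
    | h i' h1 h2 => exact (HF _ _ _ (by intro h; subst h; omega) (by intro h; subst h; omega)).symm
    | f i' j' h1' h2' hj' =>
      by_cases h : i = i'
      · subst h
        have : j = j' := Fin.ext (by omega)
        subst this
        exact Commute.refl _
      · have : i.val ≠ i'.val := fun e => h (Fin.ext e)
        exact FF _ _ _ _ h (by intro h; subst h; omega) (by intro h; subst h; omega)
          (by intro h; subst h; omega)
    | g i' j' h1' h2' hj' => exact (GF' _ _ _ _ h1' h2' hj' h1 h2 hj).symm
  | g i j h1 h2 hj =>
    cases hY with
    | e i' h' =>
      exact ((EH _ _ (by intro h; subst h; omega)).add_right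
        (EH _ _ (by intro h; subst h; omega))).symm
    | h i' h1 h2 => exact ((HH _ _).add_right (HH _ _)).symm
    | f i' j' h1' h2' hj' => exact GF' _ _ _ _ h1 h2 hj h1' h2' hj'
    | g i' j' h1' h2' hj' =>
      exact ((HH _ _).add_right (HH _ _)).add_left ((HH _ _).add_right (HH _ _))

def wv (n : ℕ) : VV n := fun _ => (1, 1)

abbrev Alg (ke kh n : ℕ) : Subalgebra ℝ (Module.End ℝ (VV n)) :=
  Algebra.adjoin ℝ {X | Gen ke kh X}

def orb (ke kh n : ℕ) : Submodule ℝ (VV n) :=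
  (Subalgebra.toSubmodule (Alg ke kh n)).map (LinearMap.applyₗ (wv n))

lemma mem_orb {ke kh n : ℕ} {z : VV n} : z ∈ orb ke kh n ↔ ∃ T ∈ Alg ke kh n, T (wv n) = z := by
  simp [orb]

lemma orb_gen {ke kh n : ℕ} {X : VV n →ₗ[ℝ] VV n} (hX : Gen ke kh X) {z : VV n}
    (hz : z ∈ orb ke kh n) : X z ∈ orb ke kh n := by
  rw [mem_orb] at *
  obtain ⟨T, hT, rfl⟩ := hz
  exact ⟨X * T, mul_mem (Algebra.subset_adjoin hX) hT, rfl⟩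

lemma orb_w (ke kh n : ℕ) : wv n ∈ orb ke kh n := mem_orb.2 ⟨1, one_mem _, rfl⟩

lemma orb_pair {ke kh n : ℕ} (i j : Fin n) (h1 : ke + kh ≤ i.val)
    (h2 : (i.val - (ke + kh)) % 2 = 0) (hj : j.val = i.val + 1) (a b : ℝ × ℝ) :
    Pi.single i a + Pi.single j b ∈ orb ke kh n := by
  have hij : i ≠ j := by intro h; subst h; omega
  have F := Gen.f (ke := ke) (kh := kh) i j h1 h2 hj
  have G := Gen.g (ke := ke) (kh := kh) i j h1 h2 hj
  have w := orb_w ke kh n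
  have e : (Pi.single i a + Pi.single j b : VV n) =
      ((b.1 + b.2 - a.1 - a.2) / 4) • opF i j (wv n)
      + ((a.1 - a.2 + b.1 - b.2) / 4) • (opH i + opH j) (wv n)
      + ((a.1 + a.2 + b.1 + b.2) / 4) • (opH i + opH j) ((opH i + opH j) (wv n))
      + ((b.1 - b.2 - a.1 + a.2) / 4) • (opH i + opH j) (opF i j (wv n)) := by
    funext k
    simp only [LinearMap.add_apply, Pi.add_apply, Pi.smul_apply, opH_apply, opF_apply, wv,
      Pi.single_apply]
    by_cases h1 : k = i
    · subst h1; ext <;> simp [hij, hij.symm] <;> ring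
    · by_cases h2 : k = j
      · subst h2; ext <;> simp [hij, hij.symm] <;> ring
      · simp [h1, h2]
  rw [e]
  exact add_mem (add_mem (add_mem (Submodule.smul_mem _ _ (orb_gen F w))
    (Submodule.smul_mem _ _ (orb_gen G w)))
    (Submodule.smul_mem _ _ (orb_gen G (orb_gen G w))))
    (Submodule.smul_mem _ _ (orb_gen G (orb_gen F w)))

lemma orb_single {ke kh kf n : ℕ} (hn : n = ke + kh + 2 * kf) (i : Fin n) (a : ℝ × ℝ) :
    Pi.single i a ∈ orb ke kh n := by
  have w := orb_w ke kh n
  by_cases c1 : i.val < ke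
  · have E := Gen.e (ke := ke) (kh := kh) i c1
    have e : (Pi.single i a : VV n) = ((a.1 - a.2) / 4) • opE i (wv n)
        + (-(a.1 + a.2) / 8) • opE i (opE i (wv n)) := by
      funext k
      simp only [Pi.add_apply, Pi.smul_apply, opE_apply, wv, Pi.single_apply]
      by_cases h : k = i
      · ext <;> simp [h] <;> ring
      · simp [h]
    rw [e]
    exact add_mem (Submodule.smul_mem _ _ (orb_gen E w))
      (Submodule.smul_mem _ _ (orb_gen E (orb_gen E w)))
  by_cases c2 : i.val < ke + kh
  · have E := Gen.h (ke := ke) (kh := kh) i (not_lt.1 c1) c2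
    have e : (Pi.single i a : VV n) = ((a.1 - a.2) / 2) • opH i (wv n)
        + ((a.1 + a.2) / 2) • opH i (opH i (wv n)) := by
      funext k
      simp only [Pi.add_apply, Pi.smul_apply, opH_apply, wv, Pi.single_apply]
      by_cases h : k = i
      · ext <;> simp [h] <;> ring
      · simp [h]
    rw [e]
    exact add_mem (Submodule.smul_mem _ _ (orb_gen E w))
      (Submodule.smul_mem _ _ (orb_gen E (orb_gen E w)))
  have hi := i.2
  by_cases c3 : (i.val - (ke + kh)) % 2 = 0
  · have := orb_pair (ke := ke) (kh := kh) i ⟨i.val + 1, by omega⟩ (by omega) c3 rfl a 0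
    simpa using this
  · have := orb_pair (ke := ke) (kh := kh) ⟨i.val - 1, by omega⟩ i (by simp; omega)
      (by simp; omega) (by simp; omega) 0 a
    simpa using this

lemma orb_all {ke kh kf n : ℕ} (hn : n = ke + kh + 2 * kf) (z : VV n) :
    ∃ T ∈ Alg ke kh n, T (wv n) = z := by
  rw [← mem_orb, ← Finset.univ_sum_single z]
  exact Submodule.sum_mem _ fun i _ => orb_single hn i _

lemma alg_comm_A {ke kh n : ℕ} {T : Module.End ℝ (VV n)} (hT : T ∈ Alg ke kh n)
    {A : VV n ≃ₗ[ℝ] VV n} (hA : A ∈ linSysPres ke kh n) (u : VV n) :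
    A (T u) = T (A u) := by
  have : Commute (A : Module.End ℝ (VV n)) T :=
    Algebra.commute_of_mem_adjoin_of_forall_mem_commute hT
      (fun X hX => (LinearMap.ext fun u => (gen_comm_A hX hA u).symm))
  exact LinearMap.congr_fun this u

lemma alg_comm {ke kh n : ℕ} {T S : Module.End ℝ (VV n)} (hT : T ∈ Alg ke kh n)
    (hS : S ∈ Alg ke kh n) (u : VV n) : S (T u) = T (S u) := by
  have : Commute S T :=
    Algebra.commute_of_mem_adjoin_of_forall_mem_commute hT
      (fun X hX => (Algebra.commute_of_mem_adjoin_of_forall_mem_commute hS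
        (fun Y hY => gen_comm hX hY)).symm)
  exact LinearMap.congr_fun this u

/-- the set `𝒢'` of invertible linear symplectic maps preserving every
component of the model moment map of Williamson type `(k_e,k_h,k_f)` is a subgroup of
`GL(2n,ℝ)` (here: of the group of linear automorphisms of `ℝ^{2n}`), and it is
commutative. -/
theorem linSysPres_subgroup_comm (ke kh kf n : ℕ) (hn : n = ke + kh + 2 * kf) :
    (∃ H : Subgroup ((Fin n → ℝ × ℝ) ≃ₗ[ℝ] (Fin n → ℝ × ℝ)),
      (H : Set ((Fin n → ℝ × ℝ) ≃ₗ[ℝ] (Fin n → ℝ × ℝ))) = linSysPres ke kh n) ∧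
    ∀ A ∈ linSysPres ke kh n, ∀ B ∈ linSysPres ke kh n,
      ∀ z : Fin n → ℝ × ℝ, A (B z) = B (A z) := by
  refine ⟨⟨{ carrier := linSysPres ke kh n, mul_mem' := ?_, one_mem' := ?_, inv_mem' := ?_ }, rfl⟩, ?_⟩
  · intro A B hA hB
    refine ⟨fun u v => ?_, fun i z => ?_⟩
    · rw [LinearEquiv.mul_apply, LinearEquiv.mul_apply, hA.1, hB.1]
    · rw [LinearEquiv.mul_apply, hA.2, hB.2]
  · exact ⟨fun _ _ => rfl, fun _ _ => rfl⟩
  · intro A hA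
    have h : ∀ z, A (A⁻¹ z) = z := fun z => A.apply_symm_apply z
    refine ⟨fun u v => ?_, fun i z => ?_⟩
    · rw [← hA.1, h, h]
    · rw [← hA.2, h]
  · intro A hA B hB z
    obtain ⟨T, hT, rfl⟩ := orb_all hn z
    obtain ⟨P, hP, hPA⟩ := orb_all hn (A (wv n))
    obtain ⟨Q, hQ, hQB⟩ := orb_all hn (B (wv n))
    rw [alg_comm_A hT hB, alg_comm_A hT hA, alg_comm_A hT hA, alg_comm_A hT hB, ← hPA, ← hQB,
      alg_comm_A hP hB, alg_comm_A hQ hA, ← hPA, ← hQB, alg_comm hP hQ]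
end

section
/- (The full group of smooth symplectomorphisms preserving the hyperbolic model is not abelian.) There exists a smooth diffeomorphism φ : ℝ² → ℝ² such that φ(0,0) = (0,0), the derivative Dφ(z) has determinant 1 at every point z (so φ preserves the standard symplectic form dx∧dy), φ preserves the hyperbolic function h(x,y) = xy (i.e. h∘φ = h), and yet φ does not commute with the involution I(x,y) = (−x,−y): φ∘I ≠ I∘φ. Since I itself is a linear symplectomorphism preserving h, the group of smooth symplectomorphisms of (ℝ², dx∧dy) fixing the origin and preserving h = xy is not abelian (in contrast with the real analytic case and with its identity path-component). -/
namespace HypAux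

noncomputable def a (t : ℝ) : ℝ := expNegInvGlue (t - 1)

noncomputable def psi (b : ℝ → ℝ) (p : ℝ × ℝ) : ℝ × ℝ :=
  (Real.exp (b (p.1 * p.2)) * p.1, Real.exp (-b (p.1 * p.2)) * p.2)

noncomputable def g (p : ℝ × ℝ) : ℝ := if 0 < p.1 then a (p.1 * p.2) else 0

noncomputable def phi (p : ℝ × ℝ) : ℝ × ℝ :=
  (Real.exp (g p) * p.1, Real.exp (-g p) * p.2)

noncomputable def phiInv (p : ℝ × ℝ) : ℝ × ℝ :=
  (Real.exp (-g p) * p.1, Real.exp (g p) * p.2)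

lemma a_smooth : ContDiff ℝ (⊤ : ℕ∞) a := by
  unfold a
  exact expNegInvGlue.contDiff.comp (contDiff_id.sub contDiff_const)

lemma psi_smooth (b : ℝ → ℝ) (hb : ContDiff ℝ (⊤ : ℕ∞) b) : ContDiff ℝ (⊤ : ℕ∞) (psi b) := by
  unfold psi
  have h : ContDiff ℝ (⊤ : ℕ∞) (fun p : ℝ × ℝ => b (p.1 * p.2)) :=
    hb.comp (contDiff_fst.mul contDiff_snd)
  exact (h.exp.mul contDiff_fst).prodMk (h.neg.exp.mul contDiff_snd)

lemma psi_det (b : ℝ → ℝ) (hb : Differentiable ℝ b) (z : ℝ × ℝ) :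
    LinearMap.det ((fderiv ℝ (psi b) z) : (ℝ × ℝ) →ₗ[ℝ] (ℝ × ℝ)) = 1 := by
  have h1 : HasFDerivAt (fun p : ℝ × ℝ => p.1) (ContinuousLinearMap.fst ℝ ℝ ℝ) z := hasFDerivAt_fst
  have h2 : HasFDerivAt (fun p : ℝ × ℝ => p.2) (ContinuousLinearMap.snd ℝ ℝ ℝ) z := hasFDerivAt_snd
  have h := (hb (z.1 * z.2)).hasDerivAt.comp_hasFDerivAt z (h1.mul h2)
  have hF := (h.exp.mul h1).prodMk (h.neg.exp.mul h2)
  have hF' : fderiv ℝ (psi b) z = _ := hF.fderiv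
  rw [hF', ← LinearMap.det_toMatrix (Module.Basis.finTwoProd ℝ), Matrix.det_fin_two]
  simp [LinearMap.toMatrix_apply]
  have he : Real.exp (b (z.1 * z.2)) * Real.exp (-b (z.1 * z.2)) = 1 := by
    rw [← Real.exp_add]; simp
  generalize Real.exp (-b (z.1 * z.2)) = F at *
  generalize Real.exp (b (z.1 * z.2)) = E at *
  linear_combination he

lemma g_zero {p : ℝ × ℝ} (h : p.1 * p.2 < 1) : g p = 0 := by
  unfold g a
  split_ifs
  · exact expNegInvGlue.zero_of_nonpos (by linarith)
  · rfl

lemma phi_local (z : ℝ × ℝ) : ∃ b : ℝ → ℝ, ContDiff ℝ (⊤ : ℕ∞) b ∧ phi =ᶠ[nhds z] psi b := by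
  by_cases h0 : 0 < z.1
  · refine ⟨a, a_smooth, ?_⟩
    filter_upwards [continuous_fst.continuousAt.eventually (lt_mem_nhds h0)] with p hp
    simp [phi, psi, g, hp]
  · refine ⟨fun _ => 0, contDiff_const, ?_⟩
    by_cases h1 : z.1 < 0
    · filter_upwards [continuous_fst.continuousAt.eventually (gt_mem_nhds h1)] with p hp
      simp [phi, psi, g, not_lt.2 hp.le]
    · have hz : z.1 * z.2 < 1 := by
        rw [show z.1 = 0 by linarith]; simp
      have hc : ContinuousAt (fun p : ℝ × ℝ => p.1 * p.2) z := by fun_prop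
      filter_upwards [hc.eventually (gt_mem_nhds hz)] with p hp
      simp [phi, psi, g_zero hp]

lemma exp_mul_neg (c : ℝ) : Real.exp c * Real.exp (-c) = 1 := by
  rw [← Real.exp_add]; simp

lemma phi_h (p : ℝ × ℝ) : (phi p).1 * (phi p).2 = p.1 * p.2 := by
  simp only [phi]
  linear_combination p.1 * p.2 * exp_mul_neg (g p)

lemma phiInv_h (p : ℝ × ℝ) : (phiInv p).1 * (phiInv p).2 = p.1 * p.2 := by
  simp only [phiInv]
  linear_combination p.1 * p.2 * exp_mul_neg (g p)

lemma g_phi (p : ℝ × ℝ) : g (phi p) = g p := by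
  have h : 0 < (phi p).1 ↔ 0 < p.1 := by simp [phi, Real.exp_pos]
  unfold g
  rw [phi_h]; simp only [h]

lemma g_phiInv (p : ℝ × ℝ) : g (phiInv p) = g p := by
  have h : 0 < (phiInv p).1 ↔ 0 < p.1 := by simp [phiInv, Real.exp_pos]
  unfold g
  rw [phiInv_h]; simp only [h]

lemma left_inv (p : ℝ × ℝ) : phiInv (phi p) = p := by
  unfold phiInv
  rw [g_phi]
  ext <;> simp only [phi]
  · linear_combination p.1 * exp_mul_neg (g p)
  · linear_combination p.2 * exp_mul_neg (g p)

lemma right_inv (p : ℝ × ℝ) : phi (phiInv p) = p := by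
  unfold phi
  rw [g_phiInv]
  ext <;> simp only [phiInv]
  · linear_combination p.1 * exp_mul_neg (g p)
  · linear_combination p.2 * exp_mul_neg (g p)

end HypAux


/-- The full group of smooth symplectomorphisms preserving the hyperbolic
model is not abelian: there is a smooth diffeomorphism `φ` of `ℝ²` fixing the origin,
with `det Dφ = 1` everywhere (so `φ` preserves `ω = dx ∧ dy`) and preserving the
hyperbolic function `h(x,y) = xy`, which does not commute with the involution
`I(x,y) = (−x,−y)`.  Since `I` is itself a linear symplectomorphism preserving `h`, the
group of smooth symplectomorphisms of `(ℝ², dx∧dy)` fixing the origin and preserving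
`h = xy` is not abelian. -/
theorem hyperbolic_symplectomorphism_group_not_abelian :
    ∃ φ : ℝ × ℝ → ℝ × ℝ,
      ContDiff ℝ (⊤ : ℕ∞) φ ∧
      Function.Bijective φ ∧
      φ (0, 0) = (0, 0) ∧
      (∀ z : ℝ × ℝ, LinearMap.det ((fderiv ℝ φ z) : (ℝ × ℝ) →ₗ[ℝ] (ℝ × ℝ)) = 1) ∧
      (∀ p : ℝ × ℝ, (φ p).1 * (φ p).2 = p.1 * p.2) ∧
      φ ∘ (fun p : ℝ × ℝ => (-p.1, -p.2)) ≠ (fun p : ℝ × ℝ => (-p.1, -p.2)) ∘ φ := by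

  refine ⟨HypAux.phi, ?_, ⟨Function.LeftInverse.injective HypAux.left_inv,
    Function.RightInverse.surjective HypAux.right_inv⟩, by simp [HypAux.phi], ?_,
    HypAux.phi_h, ?_⟩
  · rw [contDiff_iff_contDiffAt]
    intro z
    obtain ⟨b, hb, h⟩ := HypAux.phi_local z
    exact (HypAux.psi_smooth b hb).contDiffAt.congr_of_eventuallyEq h
  · intro z
    obtain ⟨b, hb, h⟩ := HypAux.phi_local z
    rw [h.fderiv_eq]
    exact HypAux.psi_det b (hb.differentiable (by simp)) z
  · intro h
    have h2 := congrArg Prod.fst (congrFun h (2, 1))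
    simp [HypAux.phi, HypAux.g, HypAux.a] at h2
    have := expNegInvGlue.pos_of_pos (x := 2 - 1) (by norm_num)
    exact absurd h2 (by first | exact this.ne' | exact this.ne)
end
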